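/- (Square-zero lemma.) Let r ≥ 0, β = (a,b) ample, f ∈ S_β nondegenerate, K = (−r−2,−2). Assume dim_ℂ R₁(f)_{3β+2K} = 1 and that the multiplication pairings R₁(f)_{β+K} × R₁(f)_{2β+K} → R₁(f)_{3β+2K} and R₁(f)_β × R₁(f)_{2β+2K} → R₁(f)_{3β+2K} are nondegenerate. Let η ∈ R₁(f)_β be such that the rank of the multiplication map R₁(f)_{β+K} → R₁(f)_{2β+K}, x ↦ η·x, is maximal (i.e., at least the rank of multiplication by η′ for every η′ ∈ R₁(f)_β). Then every α ∈ R₁(f)_{β+K} with η·α = 0 in R₁(f)_{2β+K} satisfies α² = 0 in R₁(f)_{2β+2K}. -/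

import Mathlib

open MvPolynomial

noncomputable section

/-- The Cox ring of the Hirzebruch surface: `ℂ[x₁,x₂,x₃,x₄]`. -/
abbrev S : Type := MvPolynomial (Fin 4) ℂ

/-- The ℤ²-degree of a monomial exponent vector for the Hirzebruch grading:
`deg x₁ = deg x₃ = (1,0)`, `deg x₂ = (0,1)`, `deg x₄ = (r,1)`. -/
def wdeg (r : ℕ) (c : Fin 4 →₀ ℕ) : ℤ × ℤ :=
  ((c 0 : ℤ) + (c 2 : ℤ) + (r : ℤ) * (c 3 : ℤ), (c 1 : ℤ) + (c 3 : ℤ))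

/-- The graded piece `S_γ`: the span of monomials of degree `γ`. -/
def Sgr (r : ℕ) (γ : ℤ × ℤ) : Submodule ℂ S where
  carrier := {f : S | ∀ c ∈ f.support, wdeg r c = γ}
  add_mem' := by
    intro f g hf hg c hc
    rcases Finset.mem_union.mp (MvPolynomial.support_add hc) with h | h
    · exact hf c h
    · exact hg c h
  zero_mem' := by
    intro c hc
    simp at hc
  smul_mem' := by
    intro t f hf c hc
    exact hf c (MvPolynomial.support_smul hc)

/-- The ideal `J₀(f)`, generated by `xᵢ ∂f/∂xᵢ`, `i = 1,…,4`. -/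
def J0 (f : S) : Ideal S :=
  Ideal.span {g : S | ∃ i : Fin 4, g = X i * pderiv i f}

/-- The ideal quotient `J₁(f) = J₀(f) : (x₁x₂x₃x₄)`. -/
def J1 (f : S) : Ideal S :=
  Submodule.colon (J0 f) (Ideal.span {(X 0 * X 1 * X 2 * X 3 : S)})

/-- The exceptional set `Z(Σ)` of the quotient construction of the Hirzebruch surface. -/
def Zexc : Set (Fin 4 → ℂ) :=
  {p | p 2 * p 3 = 0 ∧ p 0 * p 3 = 0 ∧ p 0 * p 1 = 0 ∧ p 1 * p 2 = 0}

/-- `f` is nondegenerate: `x₁∂f/∂x₁, …, x₄∂f/∂x₄` have no common zero outside `Z(Σ)`. -/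
def Nondeg (f : S) : Prop :=
  ∀ p : Fin 4 → ℂ, p ∉ Zexc → ∃ i : Fin 4, eval p (X i * pderiv i f) ≠ 0

/-- The graded piece `R₁(f)_γ = S_γ/(J₁(f) ∩ S_γ)`, realized as the image of `S_γ`
in the quotient ring `S ⧸ J₁(f)`. -/
def R1 (r : ℕ) (f : S) (γ : ℤ × ℤ) : Submodule ℂ (S ⧸ J1 f) :=
  (Sgr r γ).map (Ideal.Quotient.mkₐ ℂ (J1 f)).toLinearMap

/-- Nondegeneracy (on both sides) of the multiplication pairing
`R₁(f)_γ × R₁(f)_γ' → R₁(f)_{γ+γ'}`, stated elementwise: a class `[x]` is nonzero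
iff `x ∉ J₁(f)`, and the pairing of `[x]` and `[y]` is nonzero iff `x*y ∉ J₁(f)`. -/
def NondegPair (r : ℕ) (f : S) (γ γ' : ℤ × ℤ) : Prop :=
  (∀ x ∈ Sgr r γ, x ∉ J1 f → ∃ y ∈ Sgr r γ', x * y ∉ J1 f) ∧
  (∀ y ∈ Sgr r γ', y ∉ J1 f → ∃ x ∈ Sgr r γ, x * y ∉ J1 f)

/-- A linear perturbation of a linearly independent finite family is linearly independent for
some nonzero value of the parameter. -/
lemma LinearIndependent.exists_add_smul {W ι : Type*} [AddCommGroup W] [Module ℂ W]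
    [Fintype ι] {u : ι → W} (hu : LinearIndependent ℂ u) (w : ι → W) :
    ∃ t : ℂ, t ≠ 0 ∧ LinearIndependent ℂ (fun i => u i + t • w i) := by
  classical
  obtain ⟨φ, hφ⟩ := LinearMap.exists_leftInverse_of_injective
    (Fintype.linearCombination ℂ u) (LinearMap.ker_eq_bot.2 hu.fintypeLinearCombination_injective)
  have hφu : ∀ i, φ (u i) = Pi.single i 1 := fun i => by
    simpa using LinearMap.congr_fun hφ (Pi.single i 1)
  let M : ℂ → Matrix ι ι ℂ := fun t => 1 + t • Matrix.of fun i => φ (w i)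
  have hM : ContinuousAt (fun t => (M t).det) 0 := by
    apply Continuous.continuousAt
    fun_prop
  have hne : ∀ᶠ t in nhdsWithin (0 : ℂ) {0}ᶜ, (M t).det ≠ 0 :=
    (hM.eventually_ne (by simp [M])).filter_mono nhdsWithin_le_nhds
  obtain ⟨t, hdet, ht⟩ := (hne.and self_mem_nhdsWithin).exists
  refine ⟨t, ht, LinearIndependent.of_comp φ ?_⟩
  have hrows := Matrix.linearIndependent_rows_of_det_ne_zero hdet
  have hM_eq : (φ ∘ fun i => u i + t • w i) = M t := by
    ext i j
    simp [M, hφu, Matrix.one_apply, Pi.single_apply, eq_comm]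
  rw [hM_eq]
  exact hrows

/-- If `A` has maximal rank on `P` in the pencil `A + t • B`, then `B` maps the kernel of `A`
into the image of `A`. -/
lemma Submodule.apply_mem_map_of_finrank_map_le {V W : Type*} [AddCommGroup V] [Module ℂ V]
    [AddCommGroup W] [Module ℂ W] (P : Submodule ℂ V) [FiniteDimensional ℂ P]
    (A B : V →ₗ[ℂ] W)
    (h : ∀ t : ℂ, Module.finrank ℂ (P.map (A + t • B)) ≤ Module.finrank ℂ (P.map A))
    {x : V} (hx : x ∈ P) (hAx : A x = 0) : B x ∈ P.map A := by
  by_contra hBx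
  let b := Module.finBasis ℂ (P.map A)
  choose v hvP hv using fun i => Submodule.mem_map.1 (b i).2
  have hspan : Submodule.span ℂ (Set.range fun i => A (v i)) ≤ P.map A := by
    rw [Submodule.span_le]
    rintro _ ⟨i, rfl⟩
    exact Submodule.mem_map_of_mem (hvP i)
  have hind : LinearIndependent ℂ (fun i => A (v i)) := by
    simp only [hv]
    exact b.linearIndependent.map' _ (Submodule.ker_subtype _)
  have hcons : LinearIndependent ℂ (Fin.cons (B x) fun i => A (v i) : Fin (_ + 1) → W) :=
    linearIndependent_finCons.2 ⟨hind, fun hmem => hBx (hspan hmem)⟩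
  obtain ⟨t, ht, hli⟩ := hcons.exists_add_smul (Fin.cons 0 fun i => B (v i))
  have hle : Submodule.span ℂ (Set.range fun i =>
      (Fin.cons (B x) fun i => A (v i) : Fin (_ + 1) → W) i +
        t • (Fin.cons 0 fun i => B (v i) : Fin (_ + 1) → W) i) ≤ P.map (A + t • B) := by
    rw [Submodule.span_le]
    rintro _ ⟨i, rfl⟩
    refine Fin.cases ?_ (fun i => ?_) i
    · exact ⟨t⁻¹ • x, P.smul_mem _ hx, by simp [hAx, ht]⟩
    · exact ⟨v i, hvP i, by simp⟩
  have hcard := Submodule.finrank_mono hle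
  rw [finrank_span_eq_card hli, Fintype.card_fin] at hcard
  exact absurd (hcard.trans (h t)) (Nat.not_succ_le_self _)

lemma mul_mem_Sgr {r : ℕ} {γ γ' : ℤ × ℤ} {x y : S} (hx : x ∈ Sgr r γ) (hy : y ∈ Sgr r γ') :
    x * y ∈ Sgr r (γ + γ') := by
  classical
  intro c hc
  obtain ⟨d, hd, e, he, rfl⟩ := Finset.mem_add.1 (MvPolynomial.support_mul x y hc)
  rw [← hx d hd, ← hy e he]
  ext <;> simp [wdeg] <;> ring

lemma finite_setOf_wdeg_eq (r : ℕ) (γ : ℤ × ℤ) : {c | wdeg r c = γ}.Finite := by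
  refine (Set.finite_Iic (Finsupp.equivFunOnFinite.symm
    fun _ => γ.1.toNat + γ.2.toNat)).subset fun c hc => ?_
  obtain ⟨h₁, h₂⟩ := Prod.ext_iff.1 (show wdeg r c = γ from hc)
  simp only [wdeg] at h₁ h₂
  have hpos : (0 : ℤ) ≤ r * c 3 := by positivity
  intro i
  simp only [Finsupp.equivFunOnFinite_symm_apply_apply]
  fin_cases i <;> simp <;> omega

instance finiteDimensional_Sgr (r : ℕ) (γ : ℤ × ℤ) : FiniteDimensional ℂ (Sgr r γ) := by
  have : Finite {c | wdeg r c = γ} := finite_setOf_wdeg_eq r γ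
  have : Module.Finite ℂ (restrictSupport ℂ {c | wdeg r c = γ}) :=
    Module.Finite.of_basis (basisRestrictSupport ℂ _)
  exact Submodule.finiteDimensional_of_le (S₂ := restrictSupport ℂ {c | wdeg r c = γ})
    fun x hx => (mem_restrictSupport_iff ℂ).2 hx

instance finiteDimensional_R1 (r : ℕ) (f : S) (γ : ℤ × ℤ) : FiniteDimensional ℂ (R1 r f γ) := by
  unfold R1
  infer_instance

/-- Square-zero lemma: if `η ∈ R₁(f)_β` (represented by `η ∈ S_β`)
has maximal rank among the multiplication maps `R₁(f)_{β+K} → R₁(f)_{2β+K}`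
(the rank being the dimension of the image of `R₁(f)_{β+K}` under multiplication),
then every `α ∈ R₁(f)_{β+K}` with `η·α = 0` satisfies `α² = 0` in `R₁(f)_{2β+2K}`. -/
theorem stmt_9 (r : ℕ) (a b : ℤ) (hβ : (r : ℤ) * b < a ∧ 0 < b)
    (f : S) (hf : f ∈ Sgr r (a, b)) (hnd : Nondeg f)
    (h3 : Module.finrank ℂ ↥(R1 r f (3 * a - 2 * r - 4, 3 * b - 4)) = 1)
    (hp1 : NondegPair r f (a - r - 2, b - 2) (2 * a - r - 2, 2 * b - 2))
    (hp2 : NondegPair r f (a, b) (2 * a - 2 * r - 4, 2 * b - 4))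
    (η : S) (hη : η ∈ Sgr r (a, b))
    (hmax : ∀ η' ∈ Sgr r (a, b),
      Module.finrank ℂ ↥((R1 r f (a - r - 2, b - 2)).map
          (LinearMap.mulLeft ℂ (Ideal.Quotient.mk (J1 f) η')))
        ≤ Module.finrank ℂ ↥((R1 r f (a - r - 2, b - 2)).map
          (LinearMap.mulLeft ℂ (Ideal.Quotient.mk (J1 f) η)))) :
    ∀ α ∈ Sgr r (a - r - 2, b - 2), η * α ∈ J1 f → α * α ∈ J1 f := by
  intro α hα hηα
  by_contra hαα
  have hαα_mem : α * α ∈ Sgr r (2 * a - 2 * r - 4, 2 * b - 4) := by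
    convert mul_mem_Sgr hα hα using 2
    ext <;> simp <;> ring
  obtain ⟨η', hη', hne⟩ := hp2.2 _ hαα_mem hαα
  have hpencil (t : ℂ) : LinearMap.mulLeft ℂ (Ideal.Quotient.mk (J1 f) η) +
      t • LinearMap.mulLeft ℂ (Ideal.Quotient.mk (J1 f) η') =
        LinearMap.mulLeft ℂ (Ideal.Quotient.mk (J1 f) (η + t • η')) := by
    refine LinearMap.ext fun x => ?_
    simp only [LinearMap.add_apply, LinearMap.smul_apply, LinearMap.mulLeft_apply, map_add,
      add_mul]
    rw [← smul_mul_assoc]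
    rfl
  have hmem := (R1 r f (a - r - 2, b - 2)).apply_mem_map_of_finrank_map_le
    (LinearMap.mulLeft ℂ (Ideal.Quotient.mk (J1 f) η))
    (LinearMap.mulLeft ℂ (Ideal.Quotient.mk (J1 f) η')) (fun t => by
      rw [hpencil]
      exact hmax _ (add_mem hη (Submodule.smul_mem _ t hη')))
    (x := Ideal.Quotient.mk (J1 f) α) ⟨α, hα, rfl⟩
    (by rw [LinearMap.mulLeft_apply, ← map_mul]; exact Ideal.Quotient.eq_zero_iff_mem.2 hηα)
  obtain ⟨_, ⟨γ, -, rfl⟩, hγ⟩ := hmem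
  have hsub : η * γ - η' * α ∈ J1 f := by
    rw [← Ideal.Quotient.eq]
    simpa using hγ
  refine hne ?_
  have hcomb := sub_mem ((J1 f).mul_mem_left γ hηα) ((J1 f).mul_mem_left α hsub)
  convert hcomb using 1
  ring
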